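/- Theorem 2 (operator bound for the staggered energy-based DG method): With the notation of the context, for all primary broken functions w, φ of degree q_u − 1 and dual broken functions v, ψ of degree q_v, B_c(w,v;φ,ψ) ≤ (c/h) · [ ((8√3+4)/3)·(q_u + q_v − 1) + (128/(√3·π))·√(q_u·(q_v+1)) + 4·max{ c·β·q_u², (τ/c)·(q_v+1)² } ] · (c²‖w‖² + ‖v‖²)^{1/2} · (c²‖φ‖² + ‖ψ‖²)^{1/2}. -/

import Mathlib

open Polynomial

/-- Squared L² norm of a broken (piecewise polynomial) function on a periodic grid
of `N` elements each of width `h`, in local coordinates `s ∈ [0,h]`. -/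
noncomputable def brokenNormSq (N : ℕ) [NeZero N] (h : ℝ)
    (p : ZMod N → Polynomial ℝ) : ℝ :=
  ∑ j : ZMod N, ∫ s in (0:ℝ)..h, (p j).eval s ^ 2

/-- The numerical flux `H_j` of the staggered energy-based DG method, located at
the primary node `jh`, interior to the dual element `J_j`. -/
noncomputable def HfluxS (N : ℕ) [NeZero N] (h c β : ℝ)
    (w v : ZMod N → Polynomial ℝ) (j : ZMod N) : ℝ :=
  (v j).eval (h / 2) - β * c ^ 2 * ((w (j - 1)).eval h - (w j).eval 0)

/-- The numerical flux `G_j` of the staggered energy-based DG method, located at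
the primary element center `(j+1/2)h`, the shared boundary of `J_j` and `J_{j+1}`. -/
noncomputable def GfluxS (N : ℕ) [NeZero N] (h c τ : ℝ)
    (w v : ZMod N → Polynomial ℝ) (j : ZMod N) : ℝ :=
  (w j).eval (h / 2) - τ / c ^ 2 * ((v j).eval h - (v (j + 1)).eval 0)

/-- The staggered energy-based DG bilinear form `B_c(w,v;φ,ψ)`. -/
noncomputable def BformS (N : ℕ) [NeZero N] (h c β τ : ℝ)
    (w v φ ψ : ZMod N → Polynomial ℝ) : ℝ :=
  -(c ^ 2) * (∑ j : ZMod N,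
      ((∫ s in (0:ℝ)..(h / 2), (derivative (φ j)).eval s * (v j).eval (s + h / 2))
        + (∫ s in (h / 2)..h, (derivative (φ j)).eval s * (v (j + 1)).eval (s - h / 2))
        - (φ j).eval h * HfluxS N h c β w v (j + 1)
        + (φ j).eval 0 * HfluxS N h c β w v j))
    - c ^ 2 * (∑ j : ZMod N,
      ((∫ s in (0:ℝ)..(h / 2), (derivative (ψ j)).eval s * (w (j - 1)).eval (s + h / 2))
        + (∫ s in (h / 2)..h, (derivative (ψ j)).eval s * (w j).eval (s - h / 2))
        - (ψ j).eval h * GfluxS N h c τ w v j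
        + (ψ j).eval 0 * GfluxS N h c τ w v (j - 1)))

/-- integral over `[0,h]` as a linear functional on polynomials -/
noncomputable def Jint (h : ℝ) : ℝ[X] →ₗ[ℝ] ℝ where
  toFun p := ∫ s in (0:ℝ)..h, p.eval s
  map_add' p q := by
    simp only [eval_add]
    exact intervalIntegral.integral_add (p.continuous.intervalIntegrable _ _)
      (q.continuous.intervalIntegrable _ _)
  map_smul' a p := by
    simp only [eval_smul, smul_eq_mul, RingHom.id_apply]
    exact intervalIntegral.integral_const_mul _ _

lemma Jint_apply (h : ℝ) (p : ℝ[X]) : Jint h p = ∫ s in (0:ℝ)..h, p.eval s := rfl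

lemma Jint_derivative (h : ℝ) (p : ℝ[X]) : Jint h (derivative p) = p.eval h - p.eval 0 := by
  rw [Jint_apply]
  exact intervalIntegral.integral_eq_sub_of_hasDerivAt (fun x _ => p.hasDerivAt x)
    ((derivative p).continuous.intervalIntegrable _ _)

lemma Jint_sq_nonneg {h : ℝ} (hh : 0 < h) (p : ℝ[X]) : 0 ≤ Jint h (p * p) := by
  rw [Jint_apply]
  apply intervalIntegral.integral_nonneg hh.le
  intro u _
  rw [eval_mul]
  exact mul_self_nonneg _

lemma Jint_sq_pos {h : ℝ} (hh : 0 < h) (p : ℝ[X]) (hp : Jint h (p * p) = 0) : p = 0 := by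
  by_contra hne
  have hex : ∃ x ∈ Set.Icc 0 h, p.eval x ≠ 0 := by
    by_contra hcon
    push Not at hcon
    apply hne
    apply Polynomial.eq_zero_of_infinite_isRoot
    exact (Set.Icc_infinite hh).mono (fun x hx => hcon x hx)
  obtain ⟨x, hx, hpx⟩ := hex
  have : 0 < ∫ s in (0:ℝ)..h, (p * p).eval s := by
    apply intervalIntegral.integral_pos hh (p * p).continuous.continuousOn
    · intro u _
      rw [eval_mul]; exact mul_self_nonneg _
    · exact ⟨x, hx, by rw [eval_mul]; exact mul_self_pos.2 hpx⟩
  rw [Jint_apply] at hp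
  linarith

lemma exists_proj {h : ℝ} (hh : 0 < h) (n : ℕ) (p : ℝ[X]) :
    ∃ r ∈ degreeLT ℝ n, ∀ g ∈ degreeLT ℝ n, Jint h ((p - r) * g) = 0 := by
  let V := degreeLT ℝ n
  have : FiniteDimensional ℝ V := (degreeLTEquiv ℝ n).symm.finiteDimensional
  let B : ℝ[X] →ₗ[ℝ] ℝ[X] →ₗ[ℝ] ℝ := (LinearMap.mul ℝ ℝ[X]).compr₂ (Jint h)
  let T : V →ₗ[ℝ] Module.Dual ℝ V := (B.domRestrict₁₂ V V)
  have hT : ∀ a b : V, T a b = Jint h (a.1 * b.1) := fun a b => rfl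
  have hinj : Function.Injective T := by
    rw [← LinearMap.ker_eq_bot, LinearMap.ker_eq_bot']
    intro m hm
    have := hT m m
    rw [hm] at this
    exact Subtype.ext (Jint_sq_pos hh m.1 this.symm)
  have hsurj : Function.Surjective T :=
    (LinearMap.injective_iff_surjective_of_finrank_eq_finrank
      (Subspace.dual_finrank_eq (K := ℝ) (V := V)).symm).1 hinj
  obtain ⟨r, hr⟩ := hsurj ((B p).domRestrict V)
  refine ⟨r.1, r.2, fun g hg => ?_⟩
  have h1 := hT r ⟨g, hg⟩
  rw [hr] at h1
  have h2 : Jint h (p * g) = Jint h (r.1 * g) := h1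
  rw [sub_mul, map_sub, h2, sub_self]

lemma mem_dLT (n : ℕ) (p : ℝ[X]) : p ∈ degreeLT ℝ n ↔ ∀ k, n ≤ k → p.coeff k = 0 := by
  rw [mem_degreeLT, degree_lt_iff_coeff_zero]

lemma coeff_X_mul_der (p : ℝ[X]) (k : ℕ) : (X * derivative p).coeff k = k * p.coeff k := by
  cases k with
  | zero => simp
  | succ k => rw [coeff_X_mul, coeff_derivative]; push_cast; ring

lemma coeff_SL (h : ℝ) (p : ℝ[X]) (k : ℕ) :
    (derivative (X * (C h - X) * derivative p)).coeff k
      = (k + 1) * (h * (k + 1) * p.coeff (k + 1) - k * p.coeff k) := by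
  have : X * (C h - X) * derivative p
    = C h * (X * derivative p) - X * (X * derivative p) := by ring
  rw [this, coeff_derivative, coeff_sub, coeff_C_mul, coeff_X_mul_der, coeff_X_mul,
    coeff_X_mul_der]
  push_cast; ring

lemma SL_mem (h : ℝ) (n : ℕ) (r : ℝ[X]) (hr : r ∈ degreeLT ℝ n) :
    derivative (X * (C h - X) * derivative r) ∈ degreeLT ℝ n := by
  rw [mem_dLT] at *
  intro k hk
  rw [coeff_SL, hr k hk, hr (k+1) (by omega)]; ring

lemma SL_mem_top (h : ℝ) (n : ℕ) (e : ℝ[X]) (he : e ∈ degreeLT ℝ (n + 1)) :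
    derivative (X * (C h - X) * derivative e) + C ((n:ℝ) * (n + 1)) * e ∈ degreeLT ℝ n := by
  rw [mem_dLT] at *
  intro k hk
  rw [coeff_add, coeff_C_mul, coeff_SL, he (k+1) (by omega)]
  rcases hk.eq_or_lt with rfl | hk
  · ring
  · rw [he k hk]; ring

lemma Eu_mem_top (a : ℝ) (n : ℕ) (e : ℝ[X]) (he : e ∈ degreeLT ℝ (n + 1)) :
    (X - C a) * derivative e - C (n:ℝ) * e ∈ degreeLT ℝ n := by
  rw [mem_dLT] at *
  intro k hk
  rw [sub_mul, coeff_sub, coeff_sub, coeff_C_mul, coeff_C_mul, coeff_X_mul_der,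
    coeff_derivative, he (k+1) (by omega)]
  rcases hk.eq_or_lt with rfl | hk
  · ring
  · rw [he k hk]; ring

lemma dLT_mono {n : ℕ} {r : ℝ[X]} (hr : r ∈ degreeLT ℝ n) : r ∈ degreeLT ℝ (n + 1) := by
  rw [mem_dLT] at *
  intro k hk
  exact hr k (by omega)

lemma Jint_C_mul (h a : ℝ) (p : ℝ[X]) : Jint h (C a * p) = a * Jint h p := by
  rw [← smul_eq_C_mul, map_smul, smul_eq_mul]

lemma weighted_bound {h : ℝ} (hh : 0 < h) (n : ℕ) : ∀ p ∈ degreeLT ℝ n,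
    Jint h (X * (C h - X) * derivative p * derivative p) ≤ (n:ℝ) ^ 2 * Jint h (p * p) := by
  induction n with
  | zero =>
    intro p hp
    have : p = 0 := by
      ext k; exact (mem_dLT 0 p).1 hp k (Nat.zero_le _)
    subst this; simp
  | succ n ih =>
    intro p hp
    obtain ⟨r, hr, hort⟩ := exists_proj hh n p
    obtain ⟨e, rfl⟩ : ∃ e, p = e + r := ⟨p - r, by ring⟩
    simp only [add_sub_cancel_right] at hort
    have he : e ∈ degreeLT ℝ (n + 1) := by
      have := Submodule.sub_mem _ hp (dLT_mono hr)
      simpa using this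
    have key : ∀ f : ℝ[X], Jint h (X * (C h - X) * derivative f * derivative e)
        = - Jint h (e * derivative (X * (C h - X) * derivative f)) := by
      intro f
      have h1 := Jint_derivative h ((X * (C h - X) * derivative f) * e)
      rw [derivative_mul, map_add] at h1
      simp only [eval_mul, eval_sub, eval_X, eval_C, sub_self, mul_zero, zero_mul] at h1
      rw [mul_comm e]
      linarith
    have hcross := key r
    rw [hort _ (SL_mem h n r hr)] at hcross
    have hee := key e
    have h3 := hort _ (SL_mem_top h n e he)
    rw [mul_add, map_add, mul_left_comm, Jint_C_mul] at h3
    have her := hort r hr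
    have hrr := ih r hr
    have e1 : X * (C h - X) * derivative (e + r) * derivative (e + r)
      = X * (C h - X) * derivative e * derivative e
        + (X * (C h - X) * derivative r * derivative e
          + X * (C h - X) * derivative r * derivative e)
        + X * (C h - X) * derivative r * derivative r := by
      rw [derivative_add]; ring
    have e2 : (e + r) * (e + r) = e * e + (e * r + e * r) + r * r := by ring
    rw [e1, e2]
    simp only [map_add]
    rw [hcross, her]
    have p1 := Jint_sq_nonneg hh e
    have p2 := Jint_sq_nonneg hh r
    push_cast
    have hn : (0:ℝ) ≤ n := Nat.cast_nonneg n
    nlinarith [mul_nonneg hn p1, mul_nonneg hn p2]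

lemma trace_bound {h : ℝ} (hh : 0 < h) (a : ℝ) (ha : a = 0 ∨ a = h) (n : ℕ) :
    ∀ p ∈ degreeLT ℝ n, h * p.eval (h - a) ^ 2 ≤ (n:ℝ) ^ 2 * Jint h (p * p) := by
  induction n with
  | zero =>
    intro p hp
    have : p = 0 := by
      ext k; exact (mem_dLT 0 p).1 hp k (Nat.zero_le _)
    subst this; simp
  | succ n ih =>
    intro p hp
    obtain ⟨r, hr, hort⟩ := exists_proj hh n p
    obtain ⟨e, rfl⟩ : ∃ e, p = e + r := ⟨p - r, by ring⟩
    simp only [add_sub_cancel_right] at hort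
    have he : e ∈ degreeLT ℝ (n + 1) := by
      have := Submodule.sub_mem _ hp (dLT_mono hr)
      simpa using this
    have hE : h * e.eval (h - a) ^ 2 = (2 * n + 1) * Jint h (e * e) := by
      have h1 := Jint_derivative h ((X - C a) * (e * e))
      have h2 : derivative ((X - C a) * (e * e))
          = e * e + (e * ((X - C a) * derivative e) + e * ((X - C a) * derivative e)) := by
        rw [derivative_mul, derivative_mul, derivative_sub, derivative_X, derivative_C]; ring
      have h3 := hort _ (Eu_mem_top a n e he)
      rw [mul_sub, map_sub, mul_left_comm e (C _), Jint_C_mul] at h3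
      rw [h2] at h1
      simp only [map_add, eval_mul, eval_sub, eval_X, eval_C] at h1
      rcases ha with rfl | rfl
      · rw [sub_zero] at *; linarith
      · rw [sub_self] at *; linarith
    have her := hort r hr
    have hrr := ih r hr
    have e2 : (e + r) * (e + r) = e * e + (e * r + e * r) + r * r := by ring
    rw [e2]
    simp only [map_add, eval_add]
    rw [her]
    have p1 := Jint_sq_nonneg hh e
    have p2 := Jint_sq_nonneg hh r
    push_cast
    generalize Jint h (e * e) = E at *
    generalize Jint h (r * r) = R at *
    generalize e.eval (h - a) = x at *
    generalize r.eval (h - a) = y at *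
    have hn : (0:ℝ) ≤ n := Nat.cast_nonneg n
    have hx : h * (2 * x * y) ≤ n ^ 2 * E + (2 * n + 1) * R := by
      apply le_of_abs_le
      apply abs_le_of_sq_le_sq _ (by positivity)
      have q1 : (h * (2 * x * y)) ^ 2 = 4 * ((2 * n + 1) * E) * (h * y ^ 2) := by
        rw [← hE]; ring
      have q2 : 4 * ((2 * n + 1) * E) * (h * y ^ 2) ≤ 4 * ((2 * n + 1) * E) * (n ^ 2 * R) :=
        mul_le_mul_of_nonneg_left hrr (by positivity)
      nlinarith [sq_nonneg ((n:ℝ) ^ 2 * E - (2 * n + 1) * R)]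
    nlinarith

lemma pw_bound {h l M M' s t a a' b b' : ℝ} (hh : 0 < h) (hl : 0 < l) (hM : 0 < M) (hM' : 0 < M')
    (hs : 0 ≤ s) (hsh : s ≤ h / 2) (ht : s + t = h / 2) (σ : ℝ) (hσ : σ = 1 ∨ σ = -1) :
    - (2 * s / h * (a' * b) - 2 * t / h * (a * b') + σ * (2 / h) * (a * b)) ≤
      1 / h * ((l / M * (s * (h - s)) * a' ^ 2 + l * (M' + 1) * a ^ 2)
        + (1 / (l * M') * (t * (h - t)) * b' ^ 2 + (M + 1) / l * b ^ 2)) := by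
  have ht0 : 0 ≤ t := by linarith
  have k1 : -(2 * (s * a') * b) ≤ l / M * (s * (h - s)) * a' ^ 2 + M / l * b ^ 2 := by
    have : l / M * (s * (h - s)) * a' ^ 2 + M / l * b ^ 2 + 2 * (s * a') * b
      = l / M * (s * a' + M / l * b) ^ 2 + l / M * (2 * s * (h / 2 - s)) * a' ^ 2 := by
      field_simp; ring
    have h2 : 0 ≤ h / 2 - s := by linarith
    have : 0 ≤ l / M * (s * a' + M / l * b) ^ 2 + l / M * (2 * s * (h / 2 - s)) * a' ^ 2 := by
      positivity
    linarith
  have k2 : (2 * (t * b') * a) ≤ 1 / (l * M') * (t * (h - t)) * b' ^ 2 + l * M' * a ^ 2 := by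
    have : 1 / (l * M') * (t * (h - t)) * b' ^ 2 + l * M' * a ^ 2 - 2 * (t * b') * a
      = 1 / (l * M') * (t * b' - l * M' * a) ^ 2 + 1 / (l * M') * (2 * t * (h / 2 - t)) * b' ^ 2 := by
      field_simp; ring
    have h2 : 0 ≤ h / 2 - t := by linarith
    have : 0 ≤ 1 / (l * M') * (t * b' - l * M' * a) ^ 2
        + 1 / (l * M') * (2 * t * (h / 2 - t)) * b' ^ 2 := by
      positivity
    linarith
  have k3 : -(σ * (2 * a * b)) ≤ l * a ^ 2 + 1 / l * b ^ 2 := by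
    have : l * a ^ 2 + 1 / l * b ^ 2 + σ * (2 * a * b) = l * (a + σ * (1 / l) * b) ^ 2 := by
      rcases hσ with rfl | rfl <;> field_simp <;> ring
    have : 0 ≤ l * (a + σ * (1 / l) * b) ^ 2 := by positivity
    linarith
  have e1 : - (2 * s / h * (a' * b) - 2 * t / h * (a * b') + σ * (2 / h) * (a * b))
    = 1 / h * (-(2 * (s * a') * b) + (2 * (t * b') * a) + -(σ * (2 * a * b))) := by ring
  rw [e1]
  apply mul_le_mul_of_nonneg_left _ (by positivity)
  have : (M + 1) / l * b ^ 2 = M / l * b ^ 2 + 1 / l * b ^ 2 := by ring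
  linarith

/-- energy density for the test function -/
noncomputable def Ud (h l M M' : ℝ) (p : ℝ[X]) (s : ℝ) : ℝ :=
  l / M * (s * (h - s)) * (derivative p).eval s ^ 2 + l * (M' + 1) * p.eval s ^ 2

/-- energy density for the trial function -/
noncomputable def Vd (h l M M' : ℝ) (p : ℝ[X]) (s : ℝ) : ℝ :=
  1 / (l * M') * (s * (h - s)) * (derivative p).eval s ^ 2 + (M + 1) / l * p.eval s ^ 2

lemma Ud_cont (h l M M' : ℝ) (p : ℝ[X]) : Continuous (Ud h l M M' p) := by
  unfold Ud; fun_prop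

lemma Vd_cont (h l M M' : ℝ) (p : ℝ[X]) : Continuous (Vd h l M M' p) := by
  unfold Vd; fun_prop

lemma half_left {h l M M' : ℝ} (hh : 0 < h) (hl : 0 < l) (hM : 0 < M) (hM' : 0 < M')
    (p v : ℝ[X]) :
    -((∫ s in (0:ℝ)..(h / 2), (derivative p).eval s * v.eval (s + h / 2))
        + p.eval 0 * v.eval (h / 2)) ≤
      1 / h * ((∫ s in (0:ℝ)..(h / 2), Ud h l M M' p s) + ∫ s in (h / 2)..h, Vd h l M M' v s) := by
  have cU := Ud_cont h l M M' p
  have cV := Vd_cont h l M M' v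
  have sh : ∫ s in (h / 2)..h, Vd h l M M' v s
      = ∫ s in (0:ℝ)..(h / 2), Vd h l M M' v (s + h / 2) := by
    rw [intervalIntegral.integral_comp_add_right (Vd h l M M' v)]
    congr 1 <;> ring
  have hF : ∀ x : ℝ, HasDerivAt (fun s => (1 - 2 * s / h) * (p.eval s * v.eval (s + h / 2)))
      (-(2 / h) * (p.eval x * v.eval (x + h / 2)) + (1 - 2 * x / h) *
        ((derivative p).eval x * v.eval (x + h / 2)
          + p.eval x * (derivative v).eval (x + h / 2))) x := by
    intro x
    have h1 : HasDerivAt (fun s : ℝ => 1 - 2 * s / h) (-(2 / h)) x := by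
      have := (((hasDerivAt_id x).const_mul 2).div_const h).const_sub 1
      simpa using this
    have h2 : HasDerivAt (fun s : ℝ => v.eval (s + h / 2)) ((derivative v).eval (x + h / 2)) x :=
      (v.hasDerivAt (x + h / 2)).comp_add_const x (h / 2)
    exact h1.mul ((p.hasDerivAt x).mul h2)
  have hI := intervalIntegral.integral_eq_sub_of_hasDerivAt (a := 0) (b := h / 2)
    (fun x _ => hF x) ((by fun_prop : Continuous _).intervalIntegrable _ _)
  have hv0 : (1 - 2 * (h / 2) / h) = 0 := by field_simp; norm_num
  rw [hv0] at hI
  simp only [zero_mul, mul_zero, zero_div, sub_zero, one_mul, zero_add, zero_sub] at hI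
  have e : (∫ s in (0:ℝ)..(h / 2), (derivative p).eval s * v.eval (s + h / 2))
        + p.eval 0 * v.eval (h / 2) = ∫ s in (0:ℝ)..(h / 2),
          ((derivative p).eval s * v.eval (s + h / 2)
          - (-(2 / h) * (p.eval s * v.eval (s + h / 2)) + (1 - 2 * s / h) *
        ((derivative p).eval s * v.eval (s + h / 2)
          + p.eval s * (derivative v).eval (s + h / 2)))) := by
    rw [intervalIntegral.integral_sub
      ((by fun_prop : Continuous _).intervalIntegrable _ _)
      ((by fun_prop : Continuous _).intervalIntegrable _ _), hI]
    ring
  rw [e, sh, ← intervalIntegral.integral_add (cU.intervalIntegrable _ _)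
      ((by fun_prop : Continuous fun s => Vd h l M M' v (s + h / 2)).intervalIntegrable _ _),
    ← intervalIntegral.integral_const_mul, ← intervalIntegral.integral_neg]
  apply intervalIntegral.integral_mono_on (by positivity)
    ((by fun_prop : Continuous _).intervalIntegrable _ _)
    ((by fun_prop : Continuous _).intervalIntegrable _ _)
  intro s hs
  have := pw_bound (a := p.eval s) (a' := (derivative p).eval s) (b := v.eval (s + h / 2))
    (b' := (derivative v).eval (s + h / 2)) (t := h / 2 - s) hh hl hM hM' hs.1 hs.2 (by ring)
    1 (Or.inl rfl)
  unfold Ud Vd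
  convert this using 1
  · field_simp; ring
  · ring

lemma half_right {h l M M' : ℝ} (hh : 0 < h) (hl : 0 < l) (hM : 0 < M) (hM' : 0 < M')
    (p v : ℝ[X]) :
    -((∫ s in (h / 2)..h, (derivative p).eval s * v.eval (s - h / 2))
        - p.eval h * v.eval (h / 2)) ≤
      1 / h * ((∫ s in (h / 2)..h, Ud h l M M' p s) + ∫ s in (0:ℝ)..(h / 2), Vd h l M M' v s) := by
  have cU := Ud_cont h l M M' p
  have cV := Vd_cont h l M M' v
  have sh : ∫ s in (0:ℝ)..(h / 2), Vd h l M M' v s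
      = ∫ s in (h / 2)..h, Vd h l M M' v (s - h / 2) := by
    rw [intervalIntegral.integral_comp_sub_right (Vd h l M M' v)]
    congr 1 <;> ring
  have hF : ∀ x : ℝ, HasDerivAt (fun s => (2 * s / h - 1) * (p.eval s * v.eval (s - h / 2)))
      ((2 / h) * (p.eval x * v.eval (x - h / 2)) + (2 * x / h - 1) *
        ((derivative p).eval x * v.eval (x - h / 2)
          + p.eval x * (derivative v).eval (x - h / 2))) x := by
    intro x
    have h1 : HasDerivAt (fun s : ℝ => 2 * s / h - 1) (2 / h) x := by
      have := (((hasDerivAt_id x).const_mul 2).div_const h).sub_const 1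
      simpa using this
    have h2 : HasDerivAt (fun s : ℝ => v.eval (s - h / 2)) ((derivative v).eval (x - h / 2)) x :=
      (v.hasDerivAt (x - h / 2)).comp_sub_const x (h / 2)
    exact h1.mul ((p.hasDerivAt x).mul h2)
  have hI := intervalIntegral.integral_eq_sub_of_hasDerivAt (a := h / 2) (b := h)
    (fun x _ => hF x) ((by fun_prop : Continuous _).intervalIntegrable _ _)
  have hv0 : (2 * (h / 2) / h - 1) = 0 := by field_simp; norm_num
  have hv1 : (2 * h / h - 1) = 1 := by field_simp; norm_num
  have hv2 : h - h / 2 = h / 2 := by ring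
  rw [hv0, hv1, hv2] at hI
  simp only [zero_mul, sub_zero, one_mul] at hI
  have e : (∫ s in (h / 2)..h, (derivative p).eval s * v.eval (s - h / 2))
        - p.eval h * v.eval (h / 2) = ∫ s in (h / 2)..h,
          ((derivative p).eval s * v.eval (s - h / 2)
          - ((2 / h) * (p.eval s * v.eval (s - h / 2)) + (2 * s / h - 1) *
        ((derivative p).eval s * v.eval (s - h / 2)
          + p.eval s * (derivative v).eval (s - h / 2)))) := by
    rw [intervalIntegral.integral_sub
      ((by fun_prop : Continuous _).intervalIntegrable _ _)
      ((by fun_prop : Continuous _).intervalIntegrable _ _), hI]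
  rw [e, sh, ← intervalIntegral.integral_add (cU.intervalIntegrable _ _)
      ((by fun_prop : Continuous fun s => Vd h l M M' v (s - h / 2)).intervalIntegrable _ _),
    ← intervalIntegral.integral_const_mul, ← intervalIntegral.integral_neg]
  apply intervalIntegral.integral_mono_on (by linarith)
    ((by fun_prop : Continuous _).intervalIntegrable _ _)
    ((by fun_prop : Continuous _).intervalIntegrable _ _)
  intro s hs
  have := pw_bound (a := p.eval s) (a' := (derivative p).eval s) (b := v.eval (s - h / 2))
    (b' := (derivative v).eval (s - h / 2)) (s := h - s) (t := s - h / 2) hh hl hM hM'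
    (by linarith [hs.2]) (by linarith [hs.1]) (by ring)
    (-1) (Or.inr rfl)
  unfold Ud Vd
  convert this using 1
  · field_simp; ring
  · ring

lemma Ud_int {h l M' : ℝ} (hh : 0 < h) (hl : 0 < l) (m : ℕ) (hm : 1 ≤ m)
    (p : ℝ[X]) (hp : p ∈ degreeLT ℝ m) :
    (∫ s in (0:ℝ)..h, Ud h l m M' p s) ≤ l * (m + M' + 1) * ∫ s in (0:ℝ)..h, p.eval s ^ 2 := by
  have hw := weighted_bound hh m p hp
  have hm0 : (0:ℝ) < m := by exact_mod_cast hm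
  have e : (∫ s in (0:ℝ)..h, Ud h l m M' p s)
    = l / m * Jint h (X * (C h - X) * derivative p * derivative p)
      + l * (M' + 1) * Jint h (p * p) := by
    rw [← Jint_C_mul, ← Jint_C_mul, ← map_add, Jint_apply]
    congr 1; ext s
    simp [Ud]; ring
  have e2 : ∫ s in (0:ℝ)..h, p.eval s ^ 2 = Jint h (p * p) := by
    rw [Jint_apply]; congr 1; ext s; simp [pow_two]
  rw [e, e2]
  have := mul_le_mul_of_nonneg_left hw (by positivity : 0 ≤ l / m)
  have e3 : l / m * ((m:ℝ) ^ 2 * Jint h (p * p)) = l * m * Jint h (p * p) := by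
    field_simp
  rw [e3] at this
  nlinarith

lemma Vd_eq (h l M M' : ℝ) (p : ℝ[X]) : Vd h l M M' p = Ud h l⁻¹ M' M p := by
  ext s; unfold Vd Ud; field_simp

/-- the central part of the form -/
noncomputable def Smain (N : ℕ) [NeZero N] (h : ℝ) (p v : ZMod N → ℝ[X]) : ℝ :=
  ∑ j : ZMod N,
      ((∫ s in (0:ℝ)..(h / 2), (derivative (p j)).eval s * (v j).eval (s + h / 2))
        + (∫ s in (h / 2)..h, (derivative (p j)).eval s * (v (j + 1)).eval (s - h / 2))
        - (p j).eval h * (v (j + 1)).eval (h / 2)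
        + (p j).eval 0 * (v j).eval (h / 2))

lemma brokenNormSq_nonneg (N : ℕ) [NeZero N] {h : ℝ} (hh : 0 < h) (p : ZMod N → ℝ[X]) :
    0 ≤ brokenNormSq N h p :=
  Finset.sum_nonneg fun _ _ => intervalIntegral.integral_nonneg hh.le fun _ _ => sq_nonneg _

lemma Smain_bound_l (N : ℕ) [NeZero N] {h l : ℝ} (hh : 0 < h) (hl : 0 < l) (m n : ℕ)
    (hm : 1 ≤ m) (hn : 1 ≤ n) (p v : ZMod N → ℝ[X]) (hp : ∀ j, p j ∈ degreeLT ℝ m)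
    (hv : ∀ j, v j ∈ degreeLT ℝ n) :
    - Smain N h p v ≤ 1 / h * (m + n + 1) *
      (l * brokenNormSq N h p + l⁻¹ * brokenNormSq N h v) := by
  have hm0 : (0:ℝ) < m := by exact_mod_cast hm
  have hn0 : (0:ℝ) < n := by exact_mod_cast hn
  have s1 : - Smain N h p v ≤ ∑ j : ZMod N, (1 / h *
      ((∫ s in (0:ℝ)..(h / 2), Ud h l m n (p j) s) + ∫ s in (h / 2)..h, Vd h l m n (v j) s)
      + 1 / h * ((∫ s in (h / 2)..h, Ud h l m n (p j) s)
        + ∫ s in (0:ℝ)..(h / 2), Vd h l m n (v (j + 1)) s)) := by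
    rw [Smain, ← Finset.sum_neg_distrib]
    apply Finset.sum_le_sum
    intro j _
    have a1 := half_left hh hl hm0 hn0 (p j) (v j)
    have a2 := half_right hh hl hm0 hn0 (p j) (v (j + 1))
    linarith
  have s2 : ∑ j : ZMod N, (∫ s in (0:ℝ)..(h / 2), Vd h l m n (v (j + 1)) s)
      = ∑ j : ZMod N, ∫ s in (0:ℝ)..(h / 2), Vd h l m n (v j) s :=
    Equiv.sum_comp (Equiv.addRight (1 : ZMod N))
      (fun j => ∫ s in (0:ℝ)..(h / 2), Vd h l m n (v j) s)
  have s3 : ∑ j : ZMod N, (1 / h *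
      ((∫ s in (0:ℝ)..(h / 2), Ud h l m n (p j) s) + ∫ s in (h / 2)..h, Vd h l m n (v j) s)
      + 1 / h * ((∫ s in (h / 2)..h, Ud h l m n (p j) s)
        + ∫ s in (0:ℝ)..(h / 2), Vd h l m n (v (j + 1)) s))
      = 1 / h * ∑ j : ZMod N, ((∫ s in (0:ℝ)..h, Ud h l m n (p j) s)
        + ∫ s in (0:ℝ)..h, Vd h l m n (v j) s) := by
    have a : ∀ j, ∫ s in (0:ℝ)..h, Ud h l m n (p j) s = (∫ s in (0:ℝ)..(h / 2), Ud h l m n (p j) s)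
        + ∫ s in (h / 2)..h, Ud h l m n (p j) s := fun j =>
      (intervalIntegral.integral_add_adjacent_intervals
        ((Ud_cont _ _ _ _ _).intervalIntegrable _ _)
        ((Ud_cont _ _ _ _ _).intervalIntegrable _ _)).symm
    have b : ∀ j, ∫ s in (0:ℝ)..h, Vd h l m n (v j) s = (∫ s in (0:ℝ)..(h / 2), Vd h l m n (v j) s)
        + ∫ s in (h / 2)..h, Vd h l m n (v j) s := fun j =>
      (intervalIntegral.integral_add_adjacent_intervals
        ((Vd_cont _ _ _ _ _).intervalIntegrable _ _)
        ((Vd_cont _ _ _ _ _).intervalIntegrable _ _)).symm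
    simp only [a, b, ← mul_add, ← Finset.mul_sum, Finset.sum_add_distrib, s2]
    ring
  rw [s3] at s1
  refine s1.trans ?_
  rw [mul_assoc]
  apply mul_le_mul_of_nonneg_left _ (by positivity)
  unfold brokenNormSq
  rw [Finset.mul_sum, Finset.mul_sum, ← Finset.sum_add_distrib, Finset.mul_sum]
  apply Finset.sum_le_sum
  intro j _
  have a1 := Ud_int (M' := n) hh hl m hm (p j) (hp j)
  have a2 := Ud_int (M' := m) hh (inv_pos.2 hl) n hn (v j) (hv j)
  rw [← Vd_eq] at a2
  linarith

lemma opt_l {x K A B : ℝ} (hK : 0 ≤ K) (hA : 0 ≤ A) (hB : 0 ≤ B)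
    (H : ∀ l : ℝ, 0 < l → x ≤ K * (l * A + l⁻¹ * B)) :
    x ≤ 2 * K * (√A * √B) := by
  have key : ∀ ε : ℝ, 0 < ε → x ≤ 2 * K * ((√A + ε) * (√B + ε)) := by
    intro ε hε
    have a := Real.sqrt_nonneg A
    have b := Real.sqrt_nonneg B
    have h1 := H ((√B + ε) / (√A + ε)) (by positivity)
    refine h1.trans ?_
    rw [mul_comm 2 K, mul_assoc]
    apply mul_le_mul_of_nonneg_left _ hK
    have hA' : A ≤ (√A + ε) * (√A + ε) := by nlinarith [Real.mul_self_sqrt hA]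
    have hB' : B ≤ (√B + ε) * (√B + ε) := by nlinarith [Real.mul_self_sqrt hB]
    calc (√B + ε) / (√A + ε) * A + ((√B + ε) / (√A + ε))⁻¹ * B
        ≤ (√B + ε) / (√A + ε) * ((√A + ε) * (√A + ε))
          + ((√B + ε) / (√A + ε))⁻¹ * ((√B + ε) * (√B + ε)) := by gcongr
      _ = 2 * ((√A + ε) * (√B + ε)) := by field_simp; ring
  have hlim : Filter.Tendsto (fun ε : ℝ => 2 * K * ((√A + ε) * (√B + ε)))
      (nhdsWithin 0 (Set.Ioi 0)) (nhds (2 * K * (√A * √B))) := by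
    have : Continuous (fun ε : ℝ => 2 * K * ((√A + ε) * (√B + ε))) := by fun_prop
    have := (this.tendsto 0).mono_left (nhdsWithin_le_nhds (s := Set.Ioi 0))
    simpa using this
  refine ge_of_tendsto hlim ?_
  filter_upwards [self_mem_nhdsWithin] with ε hε using key ε hε

lemma Smain_bound (N : ℕ) [NeZero N] {h : ℝ} (hh : 0 < h) (m n : ℕ)
    (hm : 1 ≤ m) (hn : 1 ≤ n) (p v : ZMod N → ℝ[X]) (hp : ∀ j, p j ∈ degreeLT ℝ m)
    (hv : ∀ j, v j ∈ degreeLT ℝ n) :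
    - Smain N h p v ≤ 2 * (1 / h * (m + n + 1)) *
      (√(brokenNormSq N h p) * √(brokenNormSq N h v)) :=
  opt_l (by positivity) (brokenNormSq_nonneg N hh p) (brokenNormSq_nonneg N hh v)
    fun _ hl => Smain_bound_l N hh hl m n hm hn p v hp hv

/-- jump sums -/
lemma jump_sq (N : ℕ) [NeZero N] {h : ℝ} (hh : 0 < h) (n : ℕ) (p : ZMod N → ℝ[X])
    (hp : ∀ j, p j ∈ degreeLT ℝ n) :
    ∑ j : ZMod N, ((p j).eval h - (p (j + 1)).eval 0) ^ 2
      ≤ 4 * n ^ 2 / h * brokenNormSq N h p := by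
  have e2 : ∀ j, ∫ s in (0:ℝ)..h, (p j).eval s ^ 2 = Jint h (p j * p j) := by
    intro j
    rw [Jint_apply]; congr 1; ext s; simp [pow_two]
  have s2 : ∑ j : ZMod N, (p (j + 1)).eval 0 ^ 2 = ∑ j : ZMod N, (p j).eval 0 ^ 2 :=
    Equiv.sum_comp (Equiv.addRight (1 : ZMod N)) (fun j => (p j).eval 0 ^ 2)
  calc ∑ j : ZMod N, ((p j).eval h - (p (j + 1)).eval 0) ^ 2
      ≤ ∑ j : ZMod N, (2 * (p j).eval h ^ 2 + 2 * (p (j + 1)).eval 0 ^ 2) := by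
        apply Finset.sum_le_sum
        intro j _
        nlinarith [sq_nonneg ((p j).eval h + (p (j + 1)).eval 0)]
    _ = ∑ j : ZMod N, (2 * (p j).eval h ^ 2 + 2 * (p j).eval 0 ^ 2) := by
        rw [Finset.sum_add_distrib, Finset.sum_add_distrib, ← Finset.mul_sum, ← Finset.mul_sum,
          ← Finset.mul_sum, s2]
    _ ≤ _ := by
        unfold brokenNormSq
        rw [Finset.mul_sum]
        apply Finset.sum_le_sum
        intro j _
        have t1 := trace_bound hh 0 (Or.inl rfl) n (p j) (hp j)
        have t2 := trace_bound hh h (Or.inr rfl) n (p j) (hp j)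
        rw [sub_zero] at t1
        rw [sub_self] at t2
        rw [e2, div_mul_eq_mul_div, le_div_iff₀ hh]
        linarith

lemma jump_prod (N : ℕ) [NeZero N] {h : ℝ} (hh : 0 < h) (n : ℕ) (p r : ZMod N → ℝ[X])
    (hp : ∀ j, p j ∈ degreeLT ℝ n) (hr : ∀ j, r j ∈ degreeLT ℝ n) :
    - ∑ j : ZMod N, ((p j).eval h - (p (j + 1)).eval 0) * ((r j).eval h - (r (j + 1)).eval 0)
      ≤ 4 * n ^ 2 / h * (√(brokenNormSq N h p) * √(brokenNormSq N h r)) := by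
  have hcs := Real.sum_mul_le_sqrt_mul_sqrt Finset.univ
    (fun j : ZMod N => -((p j).eval h - (p (j + 1)).eval 0))
    (fun j : ZMod N => ((r j).eval h - (r (j + 1)).eval 0))
  simp only [neg_mul, Finset.sum_neg_distrib, neg_sq] at hcs
  refine hcs.trans ?_
  have hk : (0:ℝ) ≤ 4 * n ^ 2 / h := by positivity
  calc _ ≤ √(4 * n ^ 2 / h * brokenNormSq N h p) * √(4 * n ^ 2 / h * brokenNormSq N h r) :=
        mul_le_mul (Real.sqrt_le_sqrt (jump_sq N hh n p hp))
          (Real.sqrt_le_sqrt (jump_sq N hh n r hr)) (Real.sqrt_nonneg _) (Real.sqrt_nonneg _)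
    _ = _ := by
        rw [Real.sqrt_mul hk, Real.sqrt_mul hk]
        linear_combination (√(brokenNormSq N h p) * √(brokenNormSq N h r)) * Real.mul_self_sqrt hk

lemma Bform_eq (N : ℕ) [NeZero N] (h c β τ : ℝ) (hc : 0 < c) (w v φ ψ : ZMod N → ℝ[X]) :
    BformS N h c β τ w v φ ψ = c ^ 2 * (- Smain N h φ v)
      + c ^ 2 * (- Smain N h ψ (fun j => w (j - 1)))
      + c ^ 4 * β * (- ∑ j : ZMod N, ((w j).eval h - (w (j + 1)).eval 0)
          * ((φ j).eval h - (φ (j + 1)).eval 0))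
      + τ * (- ∑ j : ZMod N, ((v j).eval h - (v (j + 1)).eval 0)
          * ((ψ j).eval h - (ψ (j + 1)).eval 0)) := by
  have s1 : ∑ j : ZMod N, (φ (j + 1)).eval 0 * ((w j).eval h - (w (j + 1)).eval 0)
      = ∑ j : ZMod N, (φ j).eval 0 * ((w (j - 1)).eval h - (w j).eval 0) := by
    rw [← Equiv.sum_comp (Equiv.addRight (1 : ZMod N))
      (fun j => (φ j).eval 0 * ((w (j - 1)).eval h - (w j).eval 0))]
    simp
  have s2 : ∑ j : ZMod N, (ψ (j + 1)).eval 0 * ((v j).eval h - (v (j + 1)).eval 0)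
      = ∑ j : ZMod N, (ψ j).eval 0 * ((v (j - 1)).eval h - (v j).eval 0) := by
    rw [← Equiv.sum_comp (Equiv.addRight (1 : ZMod N))
      (fun j => (ψ j).eval 0 * ((v (j - 1)).eval h - (v j).eval 0))]
    simp
  have t1 : ∑ j : ZMod N, ((w j).eval h - (w (j + 1)).eval 0)
          * ((φ j).eval h - (φ (j + 1)).eval 0)
      = ∑ j : ZMod N, ((φ j).eval h * ((w j).eval h - (w (j + 1)).eval 0)
        - (φ j).eval 0 * ((w (j - 1)).eval h - (w j).eval 0)) := by
    rw [Finset.sum_sub_distrib, ← s1, ← Finset.sum_sub_distrib]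
    exact Finset.sum_congr rfl fun j _ => by ring
  have t2 : ∑ j : ZMod N, ((v j).eval h - (v (j + 1)).eval 0)
          * ((ψ j).eval h - (ψ (j + 1)).eval 0)
      = ∑ j : ZMod N, ((ψ j).eval h * ((v j).eval h - (v (j + 1)).eval 0)
        - (ψ j).eval 0 * ((v (j - 1)).eval h - (v j).eval 0)) := by
    rw [Finset.sum_sub_distrib, ← s2, ← Finset.sum_sub_distrib]
    exact Finset.sum_congr rfl fun j _ => by ring
  rw [t1, t2]
  unfold BformS Smain HfluxS GfluxS
  simp only [← Finset.sum_neg_distrib, Finset.mul_sum, ← Finset.sum_add_distrib,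
    ← Finset.sum_sub_distrib]
  refine Finset.sum_congr rfl fun j _ => ?_
  simp only [add_sub_cancel_right, sub_add_cancel]
  obtain ⟨T, hT⟩ : ∃ T, T = τ / c ^ 2 := ⟨_, rfl⟩
  have hT2 : τ = c ^ 2 * T := by rw [hT]; field_simp
  rw [← hT, hT2]
  ring

lemma mem_of_natDegree {p : ℝ[X]} {n m : ℕ} (hp : p.natDegree ≤ n) (h : n + 1 = m) :
    p ∈ degreeLT ℝ m := by
  rw [mem_dLT]
  intro k hk
  exact coeff_eq_zero_of_natDegree_lt (by omega)

lemma const_bound (qu qv : ℝ) (hqu : 1 ≤ qu) (hqv : 0 ≤ qv) :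
    2 * (qu + (qv + 1) + 1) ≤ (8 * √3 + 4) / 3 * (qu + qv - 1)
          + 128 / (√3 * Real.pi) * √(qu * (qv + 1)) := by
  have h3 : √3 ≤ 2 := by
    rw [Real.sqrt_le_left (by norm_num)]; norm_num
  have h3' : 1 ≤ √3 := by
    rw [Real.one_le_sqrt]; norm_num
  have hpi := Real.pi_le_four
  have hpi0 := Real.pi_pos
  have hs : 1 ≤ √(qu * (qv + 1)) := by
    rw [Real.one_le_sqrt]; nlinarith
  have hk : 16 ≤ 128 / (√3 * Real.pi) := by
    rw [le_div_iff₀ (by positivity)]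
    nlinarith
  have : 16 ≤ 128 / (√3 * Real.pi) * √(qu * (qv + 1)) := by nlinarith
  have : 4 * (qu + qv - 1) ≤ (8 * √3 + 4) / 3 * (qu + qv - 1) := by
    apply mul_le_mul_of_nonneg_right _ (by linarith)
    linarith
  linarith

lemma cs2 {a b x y : ℝ} : a * x + b * y ≤ √(a ^ 2 + b ^ 2) * √(x ^ 2 + y ^ 2) := by
  rw [← Real.sqrt_mul (by positivity)]
  apply Real.le_sqrt_of_sq_le
  nlinarith [sq_nonneg (a * y - b * x)]

/-- Theorem 2: operator bound for the staggered energy-based DG method. -/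
theorem staggered_operator_bound
    (N : ℕ) [NeZero N] (hN : 1 ≤ N) (h c : ℝ) (hh : 0 < h) (hc : 0 < c)
    (qu qv : ℕ) (hqu : 1 ≤ qu) (β τ : ℝ) (hβ : 0 ≤ β) (hτ : 0 ≤ τ)
    (w φ v ψ : ZMod N → Polynomial ℝ)
    (hw : ∀ j, (w j).natDegree ≤ qu - 1) (hφ : ∀ j, (φ j).natDegree ≤ qu - 1)
    (hv : ∀ j, (v j).natDegree ≤ qv) (hψ : ∀ j, (ψ j).natDegree ≤ qv) :
    BformS N h c β τ w v φ ψ ≤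
      c / h * ((8 * Real.sqrt 3 + 4) / 3 * ((qu : ℝ) + (qv : ℝ) - 1)
          + 128 / (Real.sqrt 3 * Real.pi) * Real.sqrt ((qu : ℝ) * ((qv : ℝ) + 1))
          + 4 * max (c * β * (qu : ℝ) ^ 2) (τ / c * ((qv : ℝ) + 1) ^ 2))
        * Real.sqrt (c ^ 2 * brokenNormSq N h w + brokenNormSq N h v)
        * Real.sqrt (c ^ 2 * brokenNormSq N h φ + brokenNormSq N h ψ) := by
  have mw : ∀ j, w j ∈ degreeLT ℝ qu := fun j => mem_of_natDegree (hw j) (by omega)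
  have mφ : ∀ j, φ j ∈ degreeLT ℝ qu := fun j => mem_of_natDegree (hφ j) (by omega)
  have mv : ∀ j, v j ∈ degreeLT ℝ (qv + 1) := fun j => mem_of_natDegree (hv j) rfl
  have mψ : ∀ j, ψ j ∈ degreeLT ℝ (qv + 1) := fun j => mem_of_natDegree (hψ j) rfl
  have b1 := Smain_bound N hh qu (qv + 1) hqu (by omega) φ v mφ mv
  have b2 := Smain_bound N hh (qv + 1) qu (by omega) hqu ψ (fun j => w (j - 1)) mψ
    (fun j => mw (j - 1))
  have hws : brokenNormSq N h (fun j => w (j - 1)) = brokenNormSq N h w :=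
    Equiv.sum_comp (Equiv.subRight (1 : ZMod N))
      (fun j => ∫ s in (0:ℝ)..h, (w j).eval s ^ 2)
  rw [hws] at b2
  have b3 := jump_prod N hh qu w φ mw mφ
  have b4 := jump_prod N hh (qv + 1) v ψ mv mψ
  have hconst := const_bound qu qv (by exact_mod_cast hqu) (Nat.cast_nonneg _)
  rw [Bform_eq N h c β τ hc]
  push_cast at b1 b2 b3 b4
  have sq1 := Real.sq_sqrt (brokenNormSq_nonneg N hh w)
  have sq2 := Real.sq_sqrt (brokenNormSq_nonneg N hh v)
  have sq3 := Real.sq_sqrt (brokenNormSq_nonneg N hh φ)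
  have sq4 := Real.sq_sqrt (brokenNormSq_nonneg N hh ψ)
  rw [← sq1, ← sq2, ← sq3, ← sq4]
  have n1 := Real.sqrt_nonneg (brokenNormSq N h w)
  have n2 := Real.sqrt_nonneg (brokenNormSq N h v)
  have n3 := Real.sqrt_nonneg (brokenNormSq N h φ)
  have n4 := Real.sqrt_nonneg (brokenNormSq N h ψ)
  generalize √(brokenNormSq N h w) = W at *
  generalize √(brokenNormSq N h v) = V at *
  generalize √(brokenNormSq N h φ) = P at *
  generalize √(brokenNormSq N h ψ) = Q at *
  generalize hK : (8 * √3 + 4) / 3 * ((qu : ℝ) + (qv : ℝ) - 1)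
          + 128 / (√3 * Real.pi) * √((qu : ℝ) * ((qv : ℝ) + 1)) = K at *
  have hK0 : 0 ≤ K := le_trans (by positivity) hconst
  set Mx := max (c * β * (qu : ℝ) ^ 2) (τ / c * ((qv : ℝ) + 1) ^ 2) with hMx
  have m1 : c * β * (qu : ℝ) ^ 2 ≤ Mx := le_max_left _ _
  have m2 : τ / c * ((qv : ℝ) + 1) ^ 2 ≤ Mx := le_max_right _ _
  have hMx0 : 0 ≤ Mx := le_trans (by positivity) m1
  have c1 : V * (c * P) + (c * W) * Q ≤ √(c ^ 2 * W ^ 2 + V ^ 2) * √(c ^ 2 * P ^ 2 + Q ^ 2) := by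
    have := cs2 (a := V) (b := c * W) (x := c * P) (y := Q)
    rwa [mul_pow, mul_pow, add_comm (V ^ 2)] at this
  have c2 : (c * W) * (c * P) + V * Q ≤ √(c ^ 2 * W ^ 2 + V ^ 2) * √(c ^ 2 * P ^ 2 + Q ^ 2) := by
    have := cs2 (a := c * W) (b := V) (x := c * P) (y := Q)
    rwa [mul_pow, mul_pow] at this
  rw [mul_assoc (c / h * (K + 4 * Mx))]
  generalize √(c ^ 2 * W ^ 2 + V ^ 2) * √(c ^ 2 * P ^ 2 + Q ^ 2) = R at *
  have d1 := mul_le_mul_of_nonneg_left b1 (by positivity : 0 ≤ c ^ 2)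
  have d2 := mul_le_mul_of_nonneg_left b2 (by positivity : 0 ≤ c ^ 2)
  have d3 := mul_le_mul_of_nonneg_left b3 (by positivity : 0 ≤ c ^ 4 * β)
  have d4 := mul_le_mul_of_nonneg_left b4 hτ
  have f1 : c ^ 2 * (2 * (1 / h * ((qu:ℝ) + (qv + 1) + 1)) * (P * V))
      + c ^ 2 * (2 * (1 / h * ((qv:ℝ) + 1 + qu + 1)) * (Q * W)) ≤ c / h * (K * R) := by
    calc _ = c / h * ((2 * ((qu:ℝ) + (qv + 1) + 1)) * (V * (c * P) + (c * W) * Q)) := by ring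
      _ ≤ c / h * (K * R) := by gcongr
  have f2 : c ^ 4 * β * (4 * (qu:ℝ) ^ 2 / h * (W * P)) + τ * (4 * ((qv:ℝ) + 1) ^ 2 / h * (V * Q))
      ≤ c / h * (4 * (Mx * R)) := by
    calc _ = c / h * (4 * ((c * β * (qu : ℝ) ^ 2) * ((c * W) * (c * P)))
            + 4 * 0 + (τ / c * ((qv : ℝ) + 1) ^ 2) * (V * Q) * 4) := by
          field_simp; ring
      _ ≤ c / h * (4 * (Mx * ((c * W) * (c * P))) + 4 * 0 + Mx * (V * Q) * 4) := by gcongr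
      _ = c / h * (4 * (Mx * ((c * W) * (c * P) + V * Q))) := by ring
      _ ≤ _ := by gcongr
  linarith
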